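/- arXiv:1208.0132 — 5 statements merged into one kernel-verified Lean document; each statement's English description precedes it below -/
import Mathlib

section
/- For every formal Laurent series f ∈ k((t)) there exists g ∈ k((t)) whose coefficient of t^n vanishes unless n = 0 or n is a negative integer not divisible by p, such that f − g ∈ ℘(k((t))) = {h^p − h : h ∈ k((t))}. Moreover, the coefficients of g in negative degrees are uniquely determined by f, and the constant coefficient of g is uniquely determined modulo ℘(k) = {a^p − a : a ∈ k}. -/
open HahnSeries in
theorem LaurentSeries.pow_expChar_eq {R : Type*} [CommRing R] (p : ℕ) [ExpChar R p]
    (h : LaurentSeries R) :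
    h ^ p = single ((p : ℤ) * h.order) 1 * ofPowerSeries ℤ R
      ((h.powerSeriesPart.expand p (expChar_ne_zero R p)).map (frobenius R p)) := by
  have key : (h.powerSeriesPart.expand p (expChar_ne_zero R p)).map (frobenius R p) =
      h.powerSeriesPart ^ p :=
    MvPowerSeries.map_frobenius_expand p (expChar_ne_zero R p)
  conv_lhs => rw [← h.single_order_mul_powerSeriesPart]
  rw [key, mul_pow, single_pow, one_pow, map_pow (ofPowerSeries ℤ R), nsmul_eq_mul]

open HahnSeries in
theorem LaurentSeries.coeff_pow_expChar_mul {R : Type*} [CommRing R] (p : ℕ) [ExpChar R p]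
    (h : LaurentSeries R) (n : ℤ) : (h ^ p).coeff (p * n) = h.coeff n ^ p := by
  have hp := expChar_ne_zero R p
  have hpos : (0 : ℤ) < p := by exact_mod_cast Nat.pos_of_ne_zero hp
  rw [pow_expChar_eq, coeff_single_mul, one_mul, ← mul_sub, PowerSeries.coeff_coe]
  rcases lt_or_ge n h.order with hn | hn
  · rw [if_pos (mul_neg_of_pos_of_neg hpos (by lia)), coeff_eq_zero_of_lt_order hn, zero_pow hp]
  · rw [if_neg (not_lt.mpr (mul_nonneg hpos.le (by lia))), Int.natAbs_mul, Int.natAbs_natCast,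
      PowerSeries.coeff_map, PowerSeries.coeff_expand_mul, powerSeriesPart_coeff, frobenius_def]
    congr 2
    lia

open HahnSeries in
theorem LaurentSeries.coeff_pow_expChar_of_not_dvd {R : Type*} [CommRing R] (p : ℕ) [ExpChar R p]
    (h : LaurentSeries R) {n : ℤ} (hn : ¬ (p : ℤ) ∣ n) : (h ^ p).coeff n = 0 := by
  have hp := expChar_ne_zero R p
  rw [pow_expChar_eq, coeff_single_mul, one_mul, PowerSeries.coeff_coe]
  split_ifs with h0
  · rfl
  · rw [PowerSeries.coeff_map, PowerSeries.coeff_expand_of_not_dvd, map_zero]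
    rwa [← Int.natCast_dvd, dvd_sub_left (dvd_mul_right _ _)]

/-- The coefficients of the solution `h` of `h ^ p - h = ∑ c n t ^ n` (sum over `n > 0`) with
zero constant term. -/
def artinSchreierCoeff {k : Type*} [Ring k] (p : ℕ) (c : ℕ → k) (n : ℕ) : k :=
  if n = 0 then 0
  else if _h : 1 < p ∧ n ≠ 0 ∧ p ∣ n then artinSchreierCoeff p c (n / p) ^ p - c n
  else -c n
termination_by n
decreasing_by exact Nat.div_lt_self (Nat.pos_of_ne_zero _h.2.1) _h.1

/-- `f` is congruent modulo `℘(k((t)))` to a series supported in degree `0` and in negative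
degrees prime to `p`. -/
def HasArtinSchreierRep {k : Type*} [Field k] (p : ℕ) (f : LaurentSeries k) : Prop :=
  ∃ g : LaurentSeries k,
    (∀ n : ℤ, g.coeff n ≠ 0 → n = 0 ∨ (n < 0 ∧ ¬ (p : ℤ) ∣ n)) ∧
    ∃ h : LaurentSeries k, h ^ p - h = f - g

namespace HasArtinSchreierRep

variable {k : Type*} [Field k] {p : ℕ}

theorem add [ExpChar (LaurentSeries k) p] {f₁ f₂ : LaurentSeries k}
    (h₁ : HasArtinSchreierRep p f₁) (h₂ : HasArtinSchreierRep p f₂) :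
    HasArtinSchreierRep p (f₁ + f₂) := by
  obtain ⟨g₁, hg₁, u₁, hu₁⟩ := h₁
  obtain ⟨g₂, hg₂, u₂, hu₂⟩ := h₂
  refine ⟨g₁ + g₂, fun n hn ↦ ?_, u₁ + u₂, ?_⟩
  · by_cases h : g₁.coeff n = 0
    · exact hg₂ n (by simpa [h] using hn)
    · exact hg₁ n h
  · rw [add_pow_expChar]
    linear_combination hu₁ + hu₂

theorem single_neg [PerfectField k] [ExpChar k p] (hp : 1 < p) (n : ℕ) (hn : 0 < n) (a : k) :
    HasArtinSchreierRep p (HahnSeries.single (-n : ℤ) a) := by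
  induction n using Nat.strong_induction_on generalizing a with
  | _ n ih =>
    by_cases hpn : p ∣ n
    · obtain ⟨m, rfl⟩ := hpn
      have hm : 0 < m := Nat.pos_of_mul_pos_left hn
      obtain ⟨b, rfl⟩ := surjective_frobenius k p a
      obtain ⟨g, hg, u, hu⟩ := ih m (by nlinarith) hm b
      refine ⟨g, hg, u + HahnSeries.single (-m : ℤ) b, ?_⟩
      have : ExpChar (LaurentSeries k) p :=
        expChar_of_injective_ringHom (HahnSeries.C_injective (Γ := ℤ) (R := k)) p
      rw [add_pow_expChar, HahnSeries.single_pow, frobenius_def, nsmul_eq_mul, Nat.cast_mul,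
        ← mul_neg]
      linear_combination hu
    · refine ⟨HahnSeries.single (-n : ℤ) a, fun i hi ↦ ?_, 0, ?_⟩
      · obtain rfl : i = -n := by
          by_contra h
          exact hi (HahnSeries.coeff_single_of_ne h)
        exact .inr ⟨by lia, by rwa [dvd_neg, Int.natCast_dvd_natCast]⟩
      · rw [sub_self, sub_zero, zero_pow (by lia)]

theorem of_coeff_neg_eq_zero [ExpChar k p] (hp : 1 < p) {f : LaurentSeries k}
    (hf : ∀ n < 0, f.coeff n = 0) : HasArtinSchreierRep p f := by
  refine ⟨HahnSeries.single 0 (f.coeff 0), fun n hn ↦ .inl ?_,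
    HahnSeries.ofPowerSeries ℤ k (.mk (artinSchreierCoeff p fun n ↦ f.coeff n)), ?_⟩
  · by_contra h
    exact hn (HahnSeries.coeff_single_of_ne h)
  · ext n
    rw [HahnSeries.coeff_sub, HahnSeries.coeff_sub]
    by_cases hpn : (p : ℤ) ∣ n
    · obtain ⟨m, rfl⟩ := hpn
      rw [LaurentSeries.coeff_pow_expChar_mul]
      rcases lt_trichotomy m 0 with hm | rfl | hm
      · have hpm : (p : ℤ) * m < 0 := mul_neg_of_pos_of_neg (by lia) hm
        rw [PowerSeries.coeff_coe, PowerSeries.coeff_coe, if_pos hm, if_pos hpm, hf _ hpm,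
          HahnSeries.coeff_single_of_ne hpm.ne, zero_pow (by lia)]
      · rw [mul_zero, PowerSeries.coeff_coe]
        simp [artinSchreierCoeff, (by lia : p ≠ 0)]
      · lift m to ℕ using hm.le
        have hm' : p * m ≠ 0 := mul_ne_zero (by lia) (by lia)
        rw [HahnSeries.coeff_single_of_ne (by exact_mod_cast hm'), ← Nat.cast_mul,
          LaurentSeries.coeff_coe_powerSeries, LaurentSeries.coeff_coe_powerSeries,
          PowerSeries.coeff_mk, PowerSeries.coeff_mk, artinSchreierCoeff.eq_1 p _ (p * m),
          if_neg hm', dif_pos ⟨hp, hm', dvd_mul_right _ _⟩, Nat.mul_div_cancel_left _ (by lia)]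
        ring
    · have hn0 : n ≠ 0 := by rintro rfl; exact hpn (dvd_zero _)
      rw [LaurentSeries.coeff_pow_expChar_of_not_dvd p _ hpn, HahnSeries.coeff_single_of_ne hn0,
        PowerSeries.coeff_coe]
      split_ifs with hn
      · rw [hf n hn]
      · lift n to ℕ using not_lt.mp hn
        rw [Int.natCast_dvd_natCast] at hpn
        rw [Int.natAbs_natCast, PowerSeries.coeff_mk, artinSchreierCoeff, if_neg (by lia),
          dif_neg (by tauto)]
        ring

theorem of_perfectField [PerfectField k] [ExpChar k p] [ExpChar (LaurentSeries k) p]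
    (hp : 1 < p) (f : LaurentSeries k) : HasArtinSchreierRep p f := by
  suffices H : ∀ (N : ℕ) (f : LaurentSeries k), (∀ n < (-N : ℤ), f.coeff n = 0) →
      HasArtinSchreierRep p f from
    H f.order.natAbs f fun n hn ↦ HahnSeries.coeff_eq_zero_of_lt_order (by lia)
  intro N
  induction N with
  | zero => exact fun f hf ↦ of_coeff_neg_eq_zero hp (by simpa using hf)
  | succ N ih =>
    intro f hf
    rw [← sub_add_cancel f (HahnSeries.single (-(N + 1 : ℕ) : ℤ) (f.coeff (-(N + 1 : ℕ))))]
    refine add (ih _ fun n hn ↦ ?_) (single_neg hp _ N.succ_pos _)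
    rw [HahnSeries.coeff_sub]
    rcases eq_or_ne n (-(N + 1 : ℕ)) with rfl | hne
    · rw [HahnSeries.coeff_single_same, sub_self]
    · rw [HahnSeries.coeff_single_of_ne hne, hf n (by lia), sub_self]

end HasArtinSchreierRep

/-- If `h ^ p - h` has no terms in negative degrees divisible by `p`, then `h` has no terms in
negative degrees. -/
theorem LaurentSeries.coeff_eq_zero_of_pow_sub_self {k : Type*} [Field k] {p : ℕ} [ExpChar k p]
    (hp : 1 < p) {h : LaurentSeries k}
    (hh : ∀ n < 0, (h ^ p - h).coeff (p * n) = 0) {n : ℤ} (hn : n < 0) : h.coeff n = 0 := by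
  by_contra hne
  have hord : h.order < 0 := (HahnSeries.order_le_of_coeff_ne_zero hne).trans_lt hn
  have h0 : h ≠ 0 := by rintro rfl; simp at hne
  have := hh _ hord
  rw [HahnSeries.coeff_sub, coeff_pow_expChar_mul,
    HahnSeries.coeff_eq_zero_of_lt_order (i := (p : ℤ) * h.order) (by nlinarith), sub_zero] at this
  exact HahnSeries.coeff_order_eq_zero.not.mpr h0 (pow_eq_zero_iff (by lia) |>.mp this)

/-- For every Laurent series `f ∈ k((t))` there is `g` supported in degree `0` and in
negative degrees not divisible by `p`, with `f - g ∈ ℘(k((t)))`; the negative coefficients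
of `g` are unique and its constant coefficient is unique modulo `℘(k)`. -/
theorem artinSchreier_representative (p : ℕ) (hp : p.Prime) (k : Type*) [Field k]
    [PerfectField k] [CharP k p] (f : LaurentSeries k) :
    ∃ g : LaurentSeries k,
      (∀ n : ℤ, g.coeff n ≠ 0 → n = 0 ∨ (n < 0 ∧ ¬ (p : ℤ) ∣ n)) ∧
      (∃ h : LaurentSeries k, h ^ p - h = f - g) ∧
      ∀ g' : LaurentSeries k,
        (∀ n : ℤ, g'.coeff n ≠ 0 → n = 0 ∨ (n < 0 ∧ ¬ (p : ℤ) ∣ n)) →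
        (∃ h : LaurentSeries k, h ^ p - h = f - g') →
        (∀ n : ℤ, n < 0 → g'.coeff n = g.coeff n) ∧
        ∃ a : k, a ^ p - a = g'.coeff 0 - g.coeff 0 := by
  have : ExpChar k p := .prime hp
  have : ExpChar (LaurentSeries k) p :=
    expChar_of_injective_ringHom (HahnSeries.C_injective (Γ := ℤ) (R := k)) p
  have hp1 := hp.one_lt
  obtain ⟨g, hg, h, hh⟩ := HasArtinSchreierRep.of_perfectField hp1 f
  refine ⟨g, hg, ⟨h, hh⟩, fun g' hg' ⟨h', hh'⟩ ↦ ?_⟩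
  have hd : (h - h') ^ p - (h - h') = g' - g := by
    rw [sub_pow_expChar]
    linear_combination hh - hh'
  have hpn : ∀ n < 0, ((h - h') ^ p - (h - h')).coeff (p * n) = 0 := by
    intro n hn
    have hpn : (p : ℤ) * n < 0 := mul_neg_of_pos_of_neg (by lia) hn
    have hz : ∀ G : LaurentSeries k,
        (∀ n : ℤ, G.coeff n ≠ 0 → n = 0 ∨ (n < 0 ∧ ¬ (p : ℤ) ∣ n)) → G.coeff (p * n) = 0 := by
      intro G hG
      by_contra hne
      rcases hG _ hne with h0 | ⟨-, h0⟩
      · exact hpn.ne h0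
      · exact h0 (dvd_mul_right _ _)
    rw [hd, HahnSeries.coeff_sub, hz g' hg', hz g hg, sub_zero]
  refine ⟨fun n hn ↦ ?_, (h - h').coeff 0, ?_⟩
  · rw [← sub_eq_zero, ← HahnSeries.coeff_sub, ← hd]
    by_cases hdvd : (p : ℤ) ∣ n
    · obtain ⟨m, rfl⟩ := hdvd
      exact hpn m (by nlinarith)
    · rw [HahnSeries.coeff_sub, LaurentSeries.coeff_pow_expChar_of_not_dvd p _ hdvd,
        LaurentSeries.coeff_eq_zero_of_pow_sub_self hp1 hpn hn, sub_zero]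
  · rw [← HahnSeries.coeff_sub, ← hd, HahnSeries.coeff_sub (x := _ ^ p),
      ← LaurentSeries.coeff_pow_expChar_mul, mul_zero]
end

section
/- If f ∈ k((t)) has order −j where j > 0 and p ∤ j, then f ∉ ℘(k((t))): there exists no h ∈ k((t)) with h^p − h = f. -/
/-- If `f ∈ k((t))` has order `-j` with `j > 0` and `p ∤ j`, then `f ∉ ℘(k((t)))`. -/
theorem not_artinSchreier_of_order_neg_not_dvd (p : ℕ) (hp : p.Prime) (k : Type*) [Field k]
    [PerfectField k] [CharP k p] (f : LaurentSeries k) (j : ℕ) (hj : 0 < j) (hpj : ¬ p ∣ j)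
    (hf1 : f.coeff (-(j : ℤ)) ≠ 0) (hf2 : ∀ n : ℤ, n < -(j : ℤ) → f.coeff n = 0) :
    ¬ ∃ h : LaurentSeries k, h ^ p - h = f := by
  rintro ⟨h, rfl⟩
  have hh : h ≠ 0 := by
    rintro rfl
    simp [hp.ne_zero] at hf1
  have hord : (h ^ p).order = p * h.order := by
    rw [HahnSeries.order_pow, nsmul_eq_mul]
  have hlead : (h ^ p).coeff (p * h.order) ≠ 0 := by
    rw [← hord]
    exact HahnSeries.coeff_order_eq_zero.not.mpr (pow_ne_zero p hh)
  have hp2 : (2 : ℤ) ≤ p := by exact_mod_cast hp.two_le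
  have hne : (p : ℤ) * h.order ≠ -j := fun he =>
    hpj (Int.natCast_dvd_natCast.mp ((dvd_neg (α := ℤ)).mp ⟨h.order, he.symm⟩))
  rcases lt_or_ge (-(j : ℤ)) (p * h.order) with hlt | hge
  · have hlt' : -(j : ℤ) < h.order := by
      by_contra! hle
      nlinarith
    apply hf1
    rw [HahnSeries.coeff_sub, HahnSeries.coeff_eq_zero_of_lt_order (hord ▸ hlt),
      HahnSeries.coeff_eq_zero_of_lt_order hlt', sub_zero]
  · have hneg : (p : ℤ) * h.order < h.order := by nlinarith
    have hz := hf2 _ (lt_of_le_of_ne hge hne)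
    rw [HahnSeries.coeff_sub, HahnSeries.coeff_eq_zero_of_lt_order hneg, sub_zero] at hz
    exact hlead hz
end

section
/- The map α ↦ (α(x_{1,1}), …, α(x_{l,1})) is a bijection from the set of σ-equivariant k-algebra homomorphisms S → B (those α with α ∘ σ_S = σ_B ∘ α) onto the product ∏_{λ=1}^l ker(δ_B^{d_λ}), where δ_B := σ_B − id_B. -/
section EquivariantHoms

variable {k : Type*} [CommRing k] {ι : Type*} {d : ι → ℕ}
  {σS : MvPolynomial (Σ lam : ι, Fin (d lam)) k ≃ₐ[k] MvPolynomial (Σ lam : ι, Fin (d lam)) k}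
  {B : Type*} [CommRing B] [Algebra k B] {σB : B ≃ₐ[k] B}

/-- An algebra homomorphism out of a polynomial ring is equivariant as soon as it is equivariant
on the variables. -/
theorem MvPolynomial.equivariant_of_equivariant_X {τ : Type*}
    {σ : MvPolynomial τ k ≃ₐ[k] MvPolynomial τ k} {α : MvPolynomial τ k →ₐ[k] B}
    (h : ∀ t, α (σ (X t)) = σB (α (X t))) (s : MvPolynomial τ k) : α (σ s) = σB (α s) := by
  have key : α.comp (σ : MvPolynomial τ k →ₐ[k] MvPolynomial τ k) = (σB : B →ₐ[k] B).comp α :=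
    MvPolynomial.algHom_ext fun t => h t
  exact DFunLike.congr_fun key s

/-- Under an equivariant homomorphism `α`, the operator `δ = σ - id` sends `α x_{λ,i}` to
`α x_{λ,i+1}`, or to `0` when `i` is the last index. -/
theorem delta_apply_X
    (hσS : ∀ (lam : ι) (i : Fin (d lam)),
      σS (MvPolynomial.X ⟨lam, i⟩) =
        MvPolynomial.X ⟨lam, i⟩ +
          if h : (i : ℕ) + 1 < d lam then MvPolynomial.X ⟨lam, ⟨(i : ℕ) + 1, h⟩⟩ else 0)
    {α : MvPolynomial (Σ lam : ι, Fin (d lam)) k →ₐ[k] B}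
    (hα : ∀ s, α (σS s) = σB (α s)) (lam : ι) (i : Fin (d lam)) :
    σB (α (MvPolynomial.X ⟨lam, i⟩)) - α (MvPolynomial.X ⟨lam, i⟩) =
      if h : (i : ℕ) + 1 < d lam then α (MvPolynomial.X ⟨lam, ⟨(i : ℕ) + 1, h⟩⟩) else 0 := by
  rw [← hα, hσS, map_add, add_sub_cancel_left]
  split_ifs <;> simp

/-- Under an equivariant homomorphism `α`, the iterate `δ^i` sends `α x_{λ,0}` to `α x_{λ,i}`
(indices starting at `0`). -/
theorem delta_iterate_apply_X_zero
    (hσS : ∀ (lam : ι) (i : Fin (d lam)),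
      σS (MvPolynomial.X ⟨lam, i⟩) =
        MvPolynomial.X ⟨lam, i⟩ +
          if h : (i : ℕ) + 1 < d lam then MvPolynomial.X ⟨lam, ⟨(i : ℕ) + 1, h⟩⟩ else 0)
    {α : MvPolynomial (Σ lam : ι, Fin (d lam)) k →ₐ[k] B}
    (hα : ∀ s, α (σS s) = σB (α s)) (lam : ι) (h0 : 0 < d lam) (i : ℕ) (hi : i < d lam) :
    (fun x => σB x - x)^[i] (α (MvPolynomial.X ⟨lam, ⟨0, h0⟩⟩)) =
      α (MvPolynomial.X ⟨lam, ⟨i, hi⟩⟩) := by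
  induction i with
  | zero => rfl
  | succ i ih =>
    rw [Function.iterate_succ_apply', ih (Nat.lt_of_succ_lt hi)]
    exact (delta_apply_X hσS hα lam ⟨i, Nat.lt_of_succ_lt hi⟩).trans (dif_pos hi)

end EquivariantHoms

/-- Let `S = k[x_{λ,i}]` with the `σ`-action `σ(x_{λ,i}) = x_{λ,i} + x_{λ,i+1}` (and
`σ(x_{λ,d_λ}) = x_{λ,d_λ}`), and let `B` be a commutative `k`-algebra with an automorphism
`σ_B` of order dividing `p`.  Then `α ↦ (α(x_{1,1}), …, α(x_{l,1}))` is a bijection from the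
set of `σ`-equivariant `k`-algebra homomorphisms `S → B` onto `∏_λ ker(δ_B^{d_λ})`, where
`δ_B = σ_B - id`.  (Formulated as: the map is well defined into the product of kernels, and
every point of the product of kernels has a unique equivariant preimage.) -/
theorem equivariant_homs_bijection (p : ℕ) (hp : p.Prime) (k : Type*) [Field k]
    [PerfectField k] [CharP k p] (l : ℕ) (hl : 1 ≤ l) (d : Fin l → ℕ)
    (hd1 : ∀ lam, 1 ≤ d lam) (hd2 : ∀ lam, d lam ≤ p)
    (σS : MvPolynomial (Σ lam : Fin l, Fin (d lam)) k ≃ₐ[k]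
      MvPolynomial (Σ lam : Fin l, Fin (d lam)) k)
    (hσS : ∀ (lam : Fin l) (i : Fin (d lam)),
      σS (MvPolynomial.X ⟨lam, i⟩) =
        MvPolynomial.X ⟨lam, i⟩ +
          if h : (i : ℕ) + 1 < d lam then MvPolynomial.X ⟨lam, ⟨(i : ℕ) + 1, h⟩⟩ else 0)
    (B : Type*) [CommRing B] [Algebra k B] (σB : B ≃ₐ[k] B) (hσB : ∀ x, (⇑σB)^[p] x = x) :
    (∀ α : MvPolynomial (Σ lam : Fin l, Fin (d lam)) k →ₐ[k] B,
      (∀ s, α (σS s) = σB (α s)) →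
      ∀ lam : Fin l,
        (fun x => σB x - x)^[d lam] (α (MvPolynomial.X ⟨lam, ⟨0, hd1 lam⟩⟩)) = 0) ∧
    (∀ v : (lam : Fin l) → B,
      (∀ lam, (fun x => σB x - x)^[d lam] (v lam) = 0) →
      ∃! α : MvPolynomial (Σ lam : Fin l, Fin (d lam)) k →ₐ[k] B,
        (∀ s, α (σS s) = σB (α s)) ∧
        ∀ lam : Fin l, α (MvPolynomial.X ⟨lam, ⟨0, hd1 lam⟩⟩) = v lam) := by
  refine ⟨fun α hα lam => ?_, fun v hv => ?_⟩
  · have hlt : d lam - 1 < d lam := Nat.sub_lt (hd1 lam) one_pos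
    have hsucc : d lam - 1 + 1 = d lam := Nat.sub_add_cancel (hd1 lam)
    have hlast := delta_apply_X hσS hα lam ⟨d lam - 1, hlt⟩
    rw [dif_neg (by simp only; omega),
      ← delta_iterate_apply_X_zero hσS hα lam (hd1 lam) _ hlt] at hlast
    generalize α (MvPolynomial.X ⟨lam, ⟨0, hd1 lam⟩⟩) = b at hlast ⊢
    rw [← hsucc, Function.iterate_succ_apply']
    exact hlast
  · refine ⟨MvPolynomial.aeval fun t => (fun x => σB x - x)^[(t.2 : ℕ)] (v t.1),
      ⟨MvPolynomial.equivariant_of_equivariant_X ?_, fun lam => ?_⟩, ?_⟩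
    · rintro ⟨lam, i⟩
      rw [hσS, map_add, MvPolynomial.aeval_X, ← eq_sub_iff_add_eq']
      have hstep := Function.iterate_succ_apply' (fun x => σB x - x) i (v lam)
      rw [← hstep]
      split_ifs with h
      · rw [MvPolynomial.aeval_X]
      · have hid : (i : ℕ).succ = d lam := by have := i.isLt; omega
        rw [map_zero, hid, hv lam]
    · rw [MvPolynomial.aeval_X]
      rfl
    · rintro β ⟨hβ, hβv⟩
      refine MvPolynomial.algHom_ext fun ⟨lam, i⟩ => ?_
      rw [MvPolynomial.aeval_X, ← hβv lam]
      exact (delta_iterate_apply_X_zero hσS hβ lam (hd1 lam) i i.isLt).symm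
end

section
/- The module of Kähler differentials Ω_{S/R} is isomorphic as an S-module to S/(y^{p−1}·S). Consequently, the 0-th Fitting ideal of Ω_{S/R} (the Jacobian ideal of the quotient map) is the principal ideal (y^{p−1}) ⊂ S. -/
/-- The 0-th Fitting ideal of a module `M` over `A`: the ideal generated by determinants of
square matrices all of whose columns are relations among a generating family, taken over all
generating families (for finitely generated modules this agrees with the usual 0-th Fitting
ideal, independently of the chosen presentation). -/
noncomputable def fittingIdealZero (A : Type*) [CommRing A] (M : Type*) [AddCommGroup M]
    [Module A M] : Ideal A :=
  ⨆ (n : ℕ) (π : (Fin n → A) →ₗ[A] M) (_ : Function.Surjective π),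
    Ideal.span {x : A | ∃ B : Matrix (Fin n) (Fin n) A,
      (∀ i, π (fun j => B j i) = 0) ∧ x = B.det}

/-- The determinant of a matrix of relations among generators annihilates the module. -/
theorem det_smul_eq_zero_of_relations {A M : Type*} [CommRing A] [AddCommGroup M] [Module A M]
    {n : ℕ} {π : (Fin n → A) →ₗ[A] M} (hπ : Function.Surjective π)
    {B : Matrix (Fin n) (Fin n) A} (hB : ∀ i, π (fun j => B j i) = 0) (m : M) :
    B.det • m = 0 := by
  have hker : ∀ v : Fin n → A, π (B.mulVec v) = 0 := by
    intro v
    have hv : B.mulVec v = ∑ i, v i • fun j => B j i := by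
      ext j
      simp [Matrix.mulVec, dotProduct, Finset.sum_apply, mul_comm]
    simp [hv, hB]
  obtain ⟨w, rfl⟩ := hπ m
  have hw : B.mulVec (B.adjugate.mulVec w) = B.det • w := by
    rw [Matrix.mulVec_mulVec, Matrix.mul_adjugate, Matrix.smul_mulVec, Matrix.one_mulVec]
  rw [← map_smul, ← hw, hker]

/-- The 0-th Fitting ideal of a cyclic module `A / (a)` is `(a)`. -/
theorem fittingIdealZero_eq_span_singleton {A M : Type*} [CommRing A] [AddCommGroup M]
    [Module A M] {a : A} (e : M ≃ₗ[A] A ⧸ Ideal.span {a}) :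
    fittingIdealZero A M = Ideal.span {a} := by
  apply le_antisymm
  · refine iSup_le fun n => iSup_le fun π => iSup_le fun hπ => Ideal.span_le.2 ?_
    rintro _ ⟨B, hB, rfl⟩
    have h := congrArg e (det_smul_eq_zero_of_relations hπ hB (e.symm 1))
    rw [map_smul, e.apply_symm_apply, map_zero, ← map_one (Ideal.Quotient.mk _),
      Algebra.smul_def, Ideal.Quotient.algebraMap_eq, ← map_mul, mul_one] at h
    exact Ideal.Quotient.eq_zero_iff_mem.1 h
  · let π : (Fin 1 → A) →ₗ[A] M :=
      e.symm.toLinearMap ∘ₗ (Ideal.span {a}).mkQ ∘ₗ LinearMap.proj 0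
    have hπ : Function.Surjective π := by
      refine e.symm.surjective.comp ((Submodule.mkQ_surjective _).comp ?_)
      exact fun b => ⟨fun _ => b, rfl⟩
    refine le_trans ?_ (le_iSup_of_le 1 (le_iSup_of_le π (le_iSup_of_le hπ le_rfl)))
    refine Ideal.span_mono (Set.singleton_subset_iff.2 ⟨fun _ _ => a, fun i => ?_, ?_⟩)
    · have : (Ideal.span {a}).mkQ a = 0 :=
        (Submodule.Quotient.mk_eq_zero _).2 (Ideal.mem_span_singleton_self a)
      change e.symm ((Ideal.span {a}).mkQ a) = 0
      rw [this, map_zero]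
    · exact (Matrix.det_fin_one (fun _ _ => a)).symm

/-- A `k`-derivation vanishing on a subalgebra `R` is an `R`-derivation. -/
def Derivation.ofVanishing {k S N : Type*} [CommRing k] [CommRing S] [Algebra k S]
    [AddCommGroup N] [Module k N] [Module S N] (R : Subalgebra k S)
    (D : Derivation k S N) (hD : ∀ r ∈ R, D r = 0) :
    Derivation R S N where
  toFun := D
  map_add' := map_add D
  map_smul' r f := by
    rw [Algebra.smul_def, D.leibniz]
    have : D (algebraMap R S r) = 0 := hD _ r.2
    rw [this, smul_zero, add_zero]
    rfl
  map_one_eq_zero' := D.map_one_eq_zero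
  leibniz' := D.leibniz

/-- If `R` contains every variable but `X i`, the partial derivatives `∂r/∂X i` for `r ∈ R` are
multiples of `c`, and `c` annihilates `dX i`, then `Ω` over `R` is cyclic with relation `c`. -/
theorem nonempty_kaehlerDifferential_equiv_quotient {k σ : Type*} [Field k] [DecidableEq σ]
    (R : Subalgebra k (MvPolynomial σ k)) (i : σ) (c : MvPolynomial σ k)
    (hX : ∀ j ≠ i, MvPolynomial.X j ∈ R)
    (hc : c • KaehlerDifferential.D R (MvPolynomial σ k) (MvPolynomial.X i) = 0)
    (hR : ∀ r ∈ R, MvPolynomial.pderiv i r ∈ Ideal.span {c}) :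
    Nonempty (KaehlerDifferential R (MvPolynomial σ k) ≃ₗ[MvPolynomial σ k]
      MvPolynomial σ k ⧸ Ideal.span {c}) := by
  let δ : Derivation k (MvPolynomial σ k) (MvPolynomial σ k ⧸ Ideal.span {c}) :=
    (Ideal.span {c}).mkQ.compDer (MvPolynomial.pderiv i)
  have hδ : ∀ r ∈ R, δ r = 0 := fun r hr => (Submodule.Quotient.mk_eq_zero _).2 (hR r hr)
  let f := (Derivation.ofVanishing R δ hδ).liftKaehlerDifferential
  let g : (MvPolynomial σ k ⧸ Ideal.span {c}) →ₗ[MvPolynomial σ k]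
      KaehlerDifferential R (MvPolynomial σ k) :=
    (Ideal.span {c}).liftQ (LinearMap.toSpanSingleton _ _
      (KaehlerDifferential.D R (MvPolynomial σ k) (MvPolynomial.X i))) (by
        rw [Ideal.span, Submodule.span_le, Set.singleton_subset_iff]
        exact hc)
  have hf : ∀ s, f (KaehlerDifferential.D R _ s) =
      (Ideal.span {c}).mkQ (MvPolynomial.pderiv i s) :=
    fun s => Derivation.liftKaehlerDifferential_comp_D _ s
  have hg : ∀ s, g ((Ideal.span {c}).mkQ s) =
      s • KaehlerDifferential.D R (MvPolynomial σ k) (MvPolynomial.X i) := fun s => rfl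
  refine ⟨LinearEquiv.ofLinearMap f g ?_ ?_⟩
  · refine Submodule.linearMap_qext _ (LinearMap.ext_ring ?_)
    simp only [LinearMap.comp_apply, hg, one_smul, hf, MvPolynomial.pderiv_X_self,
      LinearMap.id_apply]
  · apply Derivation.liftKaehlerDifferential_unique
    have key : ((g ∘ₗ f).compDer (KaehlerDifferential.D R (MvPolynomial σ k))).restrictScalars k =
        (KaehlerDifferential.D R (MvPolynomial σ k)).restrictScalars k := by
      refine MvPolynomial.derivation_ext fun j => ?_
      change g (f (KaehlerDifferential.D R _ (MvPolynomial.X j))) =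
        KaehlerDifferential.D R _ (MvPolynomial.X j)
      rw [hf, hg]
      rcases eq_or_ne j i with rfl | hj
      · rw [MvPolynomial.pderiv_X_self, one_smul]
      · rw [MvPolynomial.pderiv_X_of_ne hj, zero_smul]
        exact ((KaehlerDifferential.D R _).map_algebraMap ⟨_, hX j hj⟩).symm
    ext s
    exact DFunLike.congr_fun key s

/-- For `S = k[x, y, z_1, …, z_(d-2)]` and `R = k[x^p - x·y^(p-1), y, z_1, …, z_(d-2)] ⊆ S`,
the module of Kähler differentials `Ω_{S/R}` is isomorphic as an `S`-module to
`S/(y^(p-1))`; consequently its 0-th Fitting ideal (the Jacobian ideal of the quotient map)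
is the principal ideal `(y^(p-1))`. -/
theorem kaehler_differential_reflection_case (p : ℕ) (hp : p.Prime) (k : Type*) [Field k]
    [PerfectField k] [CharP k p] (d : ℕ) (hd : 2 ≤ d)
    (R : Subalgebra k (MvPolynomial (Fin d) k))
    (hR : R = Algebra.adjoin k
      (insert
        (MvPolynomial.X (⟨0, by omega⟩ : Fin d) ^ p -
          MvPolynomial.X (⟨0, by omega⟩ : Fin d) *
            MvPolynomial.X (⟨1, by omega⟩ : Fin d) ^ (p - 1))
        (insert (MvPolynomial.X (⟨1, by omega⟩ : Fin d))
          {P | ∃ i : Fin d, 2 ≤ (i : ℕ) ∧ P = MvPolynomial.X i})))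
    (I : Ideal (MvPolynomial (Fin d) k))
    (hI : I = Ideal.span {MvPolynomial.X (⟨1, by omega⟩ : Fin d) ^ (p - 1)}) :
    Nonempty
      (KaehlerDifferential R (MvPolynomial (Fin d) k) ≃ₗ[MvPolynomial (Fin d) k]
        MvPolynomial (Fin d) k ⧸ I) ∧
    fittingIdealZero (MvPolynomial (Fin d) k)
        (KaehlerDifferential R (MvPolynomial (Fin d) k)) =
      I := by
  subst hI
  have hmem : ∀ j : Fin d, j ≠ ⟨0, by omega⟩ → (MvPolynomial.X j : MvPolynomial (Fin d) k) ∈ R := by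
    intro j hj
    have hj' : (j : ℕ) ≠ 0 := fun h => hj (Fin.ext h)
    rw [hR]
    apply Algebra.subset_adjoin
    by_cases h1 : (j : ℕ) = 1
    · exact Or.inr (Or.inl (congrArg MvPolynomial.X (Fin.ext h1)))
    · exact Or.inr (Or.inr ⟨j, by omega, rfl⟩)
  have hp0 : (p : MvPolynomial (Fin d) k) = 0 := CharP.cast_eq_zero _ p
  have hne : (⟨1, by omega⟩ : Fin d) ≠ ⟨0, by omega⟩ := by simp
  have hequiv := nonempty_kaehlerDifferential_equiv_quotient R ⟨0, by omega⟩
    (MvPolynomial.X (⟨1, by omega⟩ : Fin d) ^ (p - 1)) hmem ?_ ?_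
  · exact ⟨hequiv, fittingIdealZero_eq_span_singleton hequiv.some⟩
  · have hu : MvPolynomial.X (⟨0, by omega⟩ : Fin d) ^ p -
        MvPolynomial.X (⟨0, by omega⟩ : Fin d) *
          MvPolynomial.X (⟨1, by omega⟩ : Fin d) ^ (p - 1) ∈ R := by
      rw [hR]
      exact Algebra.subset_adjoin (Or.inl rfl)
    have hDu := (KaehlerDifferential.D R (MvPolynomial (Fin d) k)).map_algebraMap ⟨_, hu⟩
    have hDy := (KaehlerDifferential.D R (MvPolynomial (Fin d) k)).map_algebraMap
      ⟨_, hmem _ hne⟩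
    change KaehlerDifferential.D R (MvPolynomial (Fin d) k) (_ - _) = 0 at hDu
    change KaehlerDifferential.D R (MvPolynomial (Fin d) k) (MvPolynomial.X _) = 0 at hDy
    rw [map_sub, Derivation.leibniz, Derivation.leibniz_pow, Derivation.leibniz_pow, hDy,
      ← Nat.cast_smul_eq_nsmul (MvPolynomial (Fin d) k) p, hp0] at hDu
    simpa using hDu
  · intro r hr
    rw [hR] at hr
    induction hr using Algebra.adjoin_induction with
    | mem r hr =>
      rcases hr with rfl | rfl | ⟨j, hj, rfl⟩
      · rw [map_sub, Derivation.leibniz, Derivation.leibniz_pow, Derivation.leibniz_pow,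
          MvPolynomial.pderiv_X_of_ne hne, ← Nat.cast_smul_eq_nsmul (MvPolynomial (Fin d) k) p,
          hp0]
        simp
      · rw [MvPolynomial.pderiv_X_of_ne hne]
        exact zero_mem _
      · have hj0 : j ≠ ⟨0, by omega⟩ := by
          intro h
          have := congrArg Fin.val h
          simp only at this
          omega
        rw [MvPolynomial.pderiv_X_of_ne hj0]
        exact zero_mem _
    | algebraMap a =>
      rw [Derivation.map_algebraMap]
      exact zero_mem _
    | add a b _ _ ha hb =>
      rw [map_add]
      exact add_mem ha hb
    | mul a b _ _ ha hb =>
      rw [Derivation.leibniz]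
      exact add_mem (Ideal.mul_mem_left _ _ hb) (Ideal.mul_mem_left _ _ ha)
end

section
/- The image of the fixed subalgebra S^σ := {F ∈ S : σ(F) = F} under the k-algebra homomorphism π : S → k[x_1] given by π(x_1) = x_1 and π(x_i) = 0 for 2 ≤ i ≤ d equals the k-subalgebra k[x_1^p] of k[x_1] generated by x_1^p. (Geometrically: the map from the fixed-point locus of the G-action on V to its image in V/G is the Frobenius morphism.) -/
open MvPolynomial

section CyclicAction

variable {k : Type*} [Field k] {d : ℕ}
  {σ : MvPolynomial (Fin d) k ≃ₐ[k] MvPolynomial (Fin d) k}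
  {π : MvPolynomial (Fin d) k →ₐ[k] Polynomial k}

/-- `σ - 1` acts nilpotently on the variables: its `m`-th power shifts the index by `m`. -/
theorem sub_one_pow_apply_X
    (hσ : ∀ i : Fin d, σ (X i) = X i + if h : (i : ℕ) + 1 < d then X ⟨(i : ℕ) + 1, h⟩ else 0)
    (i : Fin d) (m : ℕ) :
    ((σ.toLinearMap - 1 : Module.End k (MvPolynomial (Fin d) k)) ^ m) (X i) =
      if h : (i : ℕ) + m < d then X ⟨(i : ℕ) + m, h⟩ else 0 := by
  induction m with
  | zero => simp
  | succ m ih =>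
    rw [pow_succ', Module.End.mul_apply, ih]
    by_cases h : (i : ℕ) + m < d
    · simp [h, hσ, add_assoc]
    · have h' : ¬ (i : ℕ) + (m + 1) < d := by omega
      simp [h, h']

/-- In characteristic `p ≥ d` the automorphism `σ ^ p` fixes every variable. -/
theorem pow_char_apply_X {p : ℕ} (hp : p.Prime) [CharP k p] (hdp : d ≤ p)
    (hσ : ∀ i : Fin d, σ (X i) = X i + if h : (i : ℕ) + 1 < d then X ⟨(i : ℕ) + 1, h⟩ else 0)
    (i : Fin d) : (σ ^ p) (X i) = X i := by
  have : Fact p.Prime := ⟨hp⟩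
  have : CharP (Module.End k (MvPolynomial (Fin d) k)) p :=
    charP_of_injective_algebraMap (algebraMap k _).injective p
  have hpow (n : ℕ) (F : MvPolynomial (Fin d) k) :
      ((σ.toLinearMap : Module.End k (MvPolynomial (Fin d) k)) ^ n) F = (σ ^ n) F := by
    induction n with
    | zero => simp
    | succ n ih => simp [pow_succ', ih]
  have h := sub_one_pow_apply_X hσ i p
  rw [dif_neg (by omega), sub_pow_char_of_commute p (Commute.one_right _), one_pow,
    LinearMap.sub_apply, hpow, Module.End.one_apply] at h
  exact sub_eq_zero.mp h

/-- The projection to the first variable is invariant under `σ`. -/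
theorem projection_apply_pow
    (hσ : ∀ i : Fin d, σ (X i) = X i + if h : (i : ℕ) + 1 < d then X ⟨(i : ℕ) + 1, h⟩ else 0)
    (hπ2 : ∀ i : Fin d, (i : ℕ) ≠ 0 → π (X i) = 0) (n : ℕ) (F : MvPolynomial (Fin d) k) :
    π ((σ ^ n) F) = π F := by
  have h : π.comp σ.toAlgHom = π := by
    refine MvPolynomial.algHom_ext fun i => ?_
    by_cases h : (i : ℕ) + 1 < d
    · simp [hσ, h, hπ2 ⟨(i : ℕ) + 1, h⟩ (Nat.succ_ne_zero _)]
    · simp [hσ, h]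
  induction n with
  | zero => simp
  | succ n ih => rw [pow_succ', AlgEquiv.mul_apply, ← ih]; exact DFunLike.congr_fun h _

/-- The product of the first `n` translates of `F` is fixed by `σ` when `σ ^ n` fixes `F`. -/
theorem apply_prod_pow_eq_self {n : ℕ} {F : MvPolynomial (Fin d) k} (h : (σ ^ n) F = F) :
    σ (∏ j ∈ Finset.range n, (σ ^ j) F) = ∏ j ∈ Finset.range n, (σ ^ j) F := by
  cases n with
  | zero => simp
  | succ n =>
    rw [map_prod]
    simp_rw [← AlgEquiv.mul_apply, ← pow_succ']
    rw [Finset.prod_range_succ, h, Finset.prod_range_succ' (fun j => (σ ^ j) F)]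
    simp

open TrivSqZeroExt in
/-- The restriction of a `σ`-invariant to the first coordinate axis has zero derivative:
compare `F` and `σ F` to first order in the direction of the second coordinate. -/
theorem derivative_projection_eq_zero (hd : 2 ≤ d)
    (hσ : ∀ i : Fin d, σ (X i) = X i + if h : (i : ℕ) + 1 < d then X ⟨(i : ℕ) + 1, h⟩ else 0)
    (hπ1 : π (X (⟨0, by omega⟩ : Fin d)) = Polynomial.X)
    (hπ2 : ∀ i : Fin d, (i : ℕ) ≠ 0 → π (X i) = 0)
    {F : MvPolynomial (Fin d) k} (hF : σ F = F) : Polynomial.derivative (π F) = 0 := by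
  let Φ : MvPolynomial (Fin d) k →ₐ[k] DualNumber (Polynomial k) :=
    aeval fun i => inl (π (X i)) + if (i : ℕ) = 1 then inr 1 else 0
  have hfst (G : MvPolynomial (Fin d) k) : (Φ G).fst = π G := by
    have : (fstHom k (Polynomial k) (Polynomial k)).comp Φ = π := by
      refine MvPolynomial.algHom_ext fun i => ?_
      by_cases h : (i : ℕ) = 1 <;> simp [Φ, h]
    exact DFunLike.congr_fun this G
  have hsnd (G : MvPolynomial (Fin d) k) :
      (Φ (σ G)).snd = (Φ G).snd + Polynomial.derivative (π G) := by
    have hfst' (G : MvPolynomial (Fin d) k) : (Φ (σ G)).fst = π G := by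
      rw [hfst]
      simpa using projection_apply_pow hσ hπ2 1 G
    induction G using MvPolynomial.induction_on with
    | C a =>
      have hC : (C a : MvPolynomial (Fin d) k) = algebraMap k _ a := rfl
      rw [hC, AlgEquiv.commutes, AlgHom.commutes π, Polynomial.algebraMap_eq,
        Polynomial.derivative_C, add_zero]
    | add G H hG hH =>
      simp only [map_add, snd_add, hG, hH]
      ring
    | mul_X G i hG =>
      have hX : (Φ (σ (X i))).snd = (Φ (X i)).snd + Polynomial.derivative (π (X i)) := by
        rcases Nat.eq_zero_or_pos (i : ℕ) with h0 | h0
        · obtain rfl : i = ⟨0, Nat.zero_lt_of_lt hd⟩ := Fin.ext h0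
          have h1 : 1 < d := hd
          simp [hσ, hπ1, Φ, h1]
        · by_cases h : (i : ℕ) + 1 < d
          · simp [hσ, hπ2 i h0.ne', Φ, h, h0.ne']
          · simp [hσ, hπ2 i h0.ne', h]
      simp only [map_mul, snd_mul, hfst', hfst, hG, hX, Polynomial.derivative_mul, smul_eq_mul,
        MulOpposite.smul_eq_mul_unop, MulOpposite.unop_op]
      ring
  simpa [hF] using hsnd F

end CyclicAction

/-- For `S = k[x_1, …, x_d]` with `σ(x_i) = x_i + x_(i+1)` (`i < d`) and `σ(x_d) = x_d`,
the image of the fixed subalgebra `S^σ` under the projection `π : S → k[x_1]`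
(`x_1 ↦ x_1`, `x_i ↦ 0` for `i ≥ 2`) is exactly `k[x_1^p]`: the fixed-point locus maps to
its image in the quotient by the Frobenius morphism. -/
theorem image_of_invariants_eq_frobenius (p : ℕ) (hp : p.Prime) (k : Type*) [Field k]
    [PerfectField k] [CharP k p] (d : ℕ) (hd2 : 2 ≤ d) (hdp : d ≤ p)
    (σ : MvPolynomial (Fin d) k ≃ₐ[k] MvPolynomial (Fin d) k)
    (hσ : ∀ i : Fin d, σ (MvPolynomial.X i) =
      MvPolynomial.X i +
        if h : (i : ℕ) + 1 < d then MvPolynomial.X ⟨(i : ℕ) + 1, h⟩ else 0)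
    (π : MvPolynomial (Fin d) k →ₐ[k] Polynomial k)
    (hπ1 : π (MvPolynomial.X (⟨0, by omega⟩ : Fin d)) = Polynomial.X)
    (hπ2 : ∀ i : Fin d, (i : ℕ) ≠ 0 → π (MvPolynomial.X i) = 0) :
    ⇑π '' {F : MvPolynomial (Fin d) k | σ F = F} =
      (Algebra.adjoin k {(Polynomial.X : Polynomial k) ^ p} : Subalgebra k (Polynomial k)) := by
  have : Fact p.Prime := ⟨hp⟩
  rw [Algebra.adjoin_singleton_eq_range_aeval]
  ext f
  constructor
  · rintro ⟨F, hF, rfl⟩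
    refine ⟨Polynomial.contract p (π F), ?_⟩
    have h := Polynomial.expand_contract p
      (derivative_projection_eq_zero hd2 hσ hπ1 hπ2 hF) hp.ne_zero
    rwa [Polynomial.expand_eq_comp_X_pow, Polynomial.comp_eq_aeval] at h
  · rintro ⟨g, rfl⟩
    let N := ∏ j ∈ Finset.range p, (σ ^ j) (X (⟨0, by omega⟩ : Fin d))
    have hN : σ N = N := apply_prod_pow_eq_self (pow_char_apply_X hp hdp hσ _)
    have hπN : π N = Polynomial.X ^ p := by
      simp only [N, map_prod, projection_apply_pow hσ hπ2, hπ1, Finset.prod_const,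
        Finset.card_range]
    refine ⟨Polynomial.aeval N g, ?_, ?_⟩
    · change σ (Polynomial.aeval N g) = Polynomial.aeval N g
      rw [← Polynomial.aeval_algHom_apply, hN]
    · rw [← Polynomial.aeval_algHom_apply, hπN]
      rfl
end
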